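/- arXiv:1105.3505 — 2 statements merged into one kernel-verified Lean document; each statement's English description precedes it below -/
import Mathlib

section
/- Let f : ℤ² → ℝ be finitely supported. Then the convolution u(m) = Σ_{n ∈ ℤ²} φ(m − n) f(n) satisfies [Au](m) = f(m) for every m ∈ ℤ². -/
open Real MeasureTheory Filter

/-- The integrand of the lattice fundamental solution. -/
noncomputable def latticeKernel (m : ℤ × ℤ) (t : ℝ × ℝ) : ℝ :=
  (Real.cos (t.1 * (m.1 : ℝ) + t.2 * (m.2 : ℝ)) - 1) /
    (4 * Real.sin (t.1 / 2) ^ 2 + 4 * Real.sin (t.2 / 2) ^ 2)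

/-- The lattice fundamental solution `φ`. -/
noncomputable def phi (m : ℤ × ℤ) : ℝ :=
  (1 / (2 * Real.pi) ^ 2) *
    ∫ t in Set.Icc (-Real.pi) Real.pi ×ˢ Set.Icc (-Real.pi) Real.pi, latticeKernel m t

/-- The discrete Laplace operator on `ℤ²`. -/
noncomputable def discLap (u : ℤ × ℤ → ℝ) (m : ℤ × ℤ) : ℝ :=
  4 * u m - u (m + (1, 0)) - u (m - (1, 0)) - u (m + (0, 1)) - u (m - (0, 1))

/-- The Euclidean norm `|m| = √(m₁² + m₂²)` of a lattice point. -/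
noncomputable def latNorm (m : ℤ × ℤ) : ℝ :=
  Real.sqrt ((m.1 : ℝ) ^ 2 + (m.2 : ℝ) ^ 2)

/-- Convolution with the lattice fundamental solution: `[Sf](m) = Σₙ φ(m−n) f(n)`. -/
noncomputable def latConv (f : ℤ × ℤ → ℝ) (m : ℤ × ℤ) : ℝ :=
  ∑ᶠ n : ℤ × ℤ, phi (m - n) * f n

/-- The Fourier symbol of `discLap`. -/
noncomputable def latticeSymbol (t : ℝ × ℝ) : ℝ :=
  4 * Real.sin (t.1 / 2) ^ 2 + 4 * Real.sin (t.2 / 2) ^ 2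

/-- The Brillouin zone `[-π, π]²`. -/
def brillouinZone : Set (ℝ × ℝ) :=
  Set.Icc (-Real.pi) Real.pi ×ˢ Set.Icc (-Real.pi) Real.pi

theorem sq_div_pi_sq_le_sin_half_sq {x : ℝ} (hx : x ∈ Set.Icc (-Real.pi) Real.pi) :
    x ^ 2 / Real.pi ^ 2 ≤ Real.sin (x / 2) ^ 2 := by
  have hπ := Real.pi_pos
  have h : |2 / Real.pi * (x / 2)| ≤ |Real.sin (x / 2)| := by
    rw [abs_mul, abs_of_pos (by positivity : 0 < 2 / Real.pi)]
    exact Real.mul_abs_le_abs_sin (abs_le.2 ⟨by linarith [hx.1], by linarith [hx.2]⟩)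
  have h' := sq_le_sq.2 h
  calc x ^ 2 / Real.pi ^ 2 = (2 / Real.pi * (x / 2)) ^ 2 := by field_simp
    _ ≤ _ := h'

theorem le_latticeSymbol {t : ℝ × ℝ} (ht : t ∈ brillouinZone) :
    4 / Real.pi ^ 2 * (t.1 ^ 2 + t.2 ^ 2) ≤ latticeSymbol t := by
  have h₁ := sq_div_pi_sq_le_sin_half_sq ht.1
  have h₂ := sq_div_pi_sq_le_sin_half_sq ht.2
  unfold latticeSymbol
  calc 4 / Real.pi ^ 2 * (t.1 ^ 2 + t.2 ^ 2)
      = 4 * (t.1 ^ 2 / Real.pi ^ 2) + 4 * (t.2 ^ 2 / Real.pi ^ 2) := by ring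
    _ ≤ _ := by gcongr

theorem latticeSymbol_nonneg (t : ℝ × ℝ) : 0 ≤ latticeSymbol t := by
  unfold latticeSymbol; positivity

theorem latticeSymbol_pos {t : ℝ × ℝ} (ht : t ∈ brillouinZone) (h0 : t ≠ 0) :
    0 < latticeSymbol t := by
  refine lt_of_lt_of_le (mul_pos (by positivity) ?_) (le_latticeSymbol ht)
  by_contra! h
  refine h0 (Prod.ext ?_ ?_) <;> simp <;> nlinarith [sq_nonneg t.1, sq_nonneg t.2]

theorem norm_latticeKernel_le (m : ℤ × ℤ) {t : ℝ × ℝ} (ht : t ∈ brillouinZone) :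
    ‖latticeKernel m t‖ ≤ Real.pi ^ 2 / 8 * ((m.1 : ℝ) ^ 2 + (m.2 : ℝ) ^ 2) := by
  set x : ℝ := t.1 * m.1 + t.2 * m.2 with hx
  have hnum : |Real.cos x - 1| ≤ x ^ 2 / 2 := by
    rw [abs_of_nonpos (by linarith [Real.cos_le_one x])]
    linarith [Real.one_sub_sq_div_two_le_cos (x := x)]
  have hcs : x ^ 2 ≤ (t.1 ^ 2 + t.2 ^ 2) * ((m.1 : ℝ) ^ 2 + (m.2 : ℝ) ^ 2) := by
    nlinarith [sq_nonneg (t.1 * m.2 - t.2 * m.1)]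
  change ‖(Real.cos x - 1) / latticeSymbol t‖ ≤ _
  rw [norm_div, Real.norm_eq_abs, Real.norm_of_nonneg (latticeSymbol_nonneg t)]
  refine div_le_of_le_mul₀ (latticeSymbol_nonneg t) (by positivity) ?_
  calc |Real.cos x - 1|
      ≤ (t.1 ^ 2 + t.2 ^ 2) * ((m.1 : ℝ) ^ 2 + (m.2 : ℝ) ^ 2) / 2 := by linarith
    _ = Real.pi ^ 2 / 8 * ((m.1 : ℝ) ^ 2 + (m.2 : ℝ) ^ 2) *
          (4 / Real.pi ^ 2 * (t.1 ^ 2 + t.2 ^ 2)) := by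
        field_simp; ring
    _ ≤ _ := by gcongr; exact le_latticeSymbol ht

theorem isCompact_brillouinZone : IsCompact brillouinZone := isCompact_Icc.prod isCompact_Icc

theorem integrableOn_latticeKernel (m : ℤ × ℤ) :
    IntegrableOn (latticeKernel m) brillouinZone := by
  refine IntegrableOn.of_bound isCompact_brillouinZone.measure_lt_top ?_ _
    (ae_restrict_of_forall_mem isCompact_brillouinZone.measurableSet
      fun t ht => norm_latticeKernel_le m ht)
  have : Measurable (latticeKernel m) := by unfold latticeKernel; fun_prop
  exact this.aestronglyMeasurable

theorem discLap_latticeKernel (m : ℤ × ℤ) {t : ℝ × ℝ} (ht : latticeSymbol t ≠ 0) :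
    discLap (fun k => latticeKernel k t) m = Real.cos (t.1 * m.1 + t.2 * m.2) := by
  have half (x : ℝ) : 4 * Real.sin (x / 2) ^ 2 = 2 - 2 * Real.cos x := by
    rw [Real.sin_sq_eq_half_sub]; ring_nf
  have key (x y : ℝ) : Real.cos (x + y) + Real.cos (x - y) = 2 * Real.cos x * Real.cos y := by
    rw [Real.cos_add, Real.cos_sub]; ring
  have h₁ := key (t.1 * m.1 + t.2 * m.2) t.1
  have h₂ := key (t.1 * m.1 + t.2 * m.2) t.2
  have hs : latticeSymbol t = 4 - 2 * Real.cos t.1 - 2 * Real.cos t.2 := by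
    unfold latticeSymbol; rw [half, half]; ring
  change 4 * (_ / latticeSymbol t) - _ / latticeSymbol t - _ / latticeSymbol t
    - _ / latticeSymbol t - _ / latticeSymbol t = _
  have e₁ : t.1 * ((m + (1, 0)).1 : ℝ) + t.2 * ((m + (1, 0)).2 : ℝ)
      = t.1 * m.1 + t.2 * m.2 + t.1 := by simp; ring
  have e₂ : t.1 * ((m - (1, 0)).1 : ℝ) + t.2 * ((m - (1, 0)).2 : ℝ)
      = t.1 * m.1 + t.2 * m.2 - t.1 := by simp; ring
  have e₃ : t.1 * ((m + (0, 1)).1 : ℝ) + t.2 * ((m + (0, 1)).2 : ℝ)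
      = t.1 * m.1 + t.2 * m.2 + t.2 := by simp; ring
  have e₄ : t.1 * ((m - (0, 1)).1 : ℝ) + t.2 * ((m - (0, 1)).2 : ℝ)
      = t.1 * m.1 + t.2 * m.2 - t.2 := by simp; ring
  rw [e₁, e₂, e₃, e₄]
  field_simp
  rw [hs]
  linear_combination -h₁ - h₂

theorem setIntegral_Icc_cos_mul_int (k : ℤ) :
    ∫ x in Set.Icc (-Real.pi) Real.pi, Real.cos (x * k) = if k = 0 then 2 * Real.pi else 0 := by
  rw [integral_Icc_eq_integral_Ioc, ← intervalIntegral.integral_of_le (by linarith [Real.pi_pos])]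
  split_ifs with hk
  · simp [hk]; ring
  · have hk' : (k : ℝ) ≠ 0 := by exact_mod_cast hk
    rw [intervalIntegral.integral_comp_mul_right (fun x => Real.cos x) hk', integral_cos]
    simp [mul_comm Real.pi, Real.sin_int_mul_pi]

theorem setIntegral_Icc_sin_mul_int (k : ℤ) :
    ∫ x in Set.Icc (-Real.pi) Real.pi, Real.sin (x * k) = 0 := by
  rw [integral_Icc_eq_integral_Ioc, ← intervalIntegral.integral_of_le (by linarith [Real.pi_pos])]
  rcases eq_or_ne k 0 with rfl | hk
  · simp
  · have hk' : (k : ℝ) ≠ 0 := by exact_mod_cast hk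
    rw [intervalIntegral.integral_comp_mul_right (fun x => Real.sin x) hk', integral_sin]
    simp

theorem setIntegral_brillouinZone_cos (m : ℤ × ℤ) :
    ∫ t in brillouinZone, Real.cos (t.1 * m.1 + t.2 * m.2) =
      if m = 0 then (2 * Real.pi) ^ 2 else 0 := by
  have hcont {g : ℝ × ℝ → ℝ} (hg : Continuous g) : IntegrableOn g brillouinZone :=
    hg.continuousOn.integrableOn_compact isCompact_brillouinZone
  simp_rw [Real.cos_add]
  rw [integral_sub (hcont (by fun_prop)) (hcont (by fun_prop))]
  simp only [brillouinZone, Measure.volume_eq_prod]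
  rw [setIntegral_prod_mul (fun x : ℝ => Real.cos (x * m.1)) (fun x : ℝ => Real.cos (x * m.2)),
    setIntegral_prod_mul (fun x : ℝ => Real.sin (x * m.1)) (fun x : ℝ => Real.sin (x * m.2)),
    setIntegral_Icc_cos_mul_int, setIntegral_Icc_cos_mul_int, setIntegral_Icc_sin_mul_int]
  obtain ⟨a, b⟩ := m
  by_cases ha : a = 0 <;> by_cases hb : b = 0 <;> simp [ha, hb, sq]

/-- `φ` is a fundamental solution of the discrete Laplacian. -/
theorem discLap_phi (m : ℤ × ℤ) : discLap phi m = if m = 0 then 1 else 0 := by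
  have hI := integrableOn_latticeKernel
  have hlin : discLap phi m = (1 / (2 * Real.pi) ^ 2) *
      ∫ t in brillouinZone, discLap (fun k => latticeKernel k t) m := by
    unfold discLap
    rw [integral_sub, integral_sub, integral_sub, integral_sub, integral_const_mul]
    · simp only [phi, brillouinZone]; ring
    · exact (hI m).const_mul 4
    · exact hI _
    · exact ((hI m).const_mul 4).sub (hI _)
    · exact hI _
    · exact (((hI m).const_mul 4).sub (hI _)).sub (hI _)
    · exact hI _
    · exact ((((hI m).const_mul 4).sub (hI _)).sub (hI _)).sub (hI _)
    · exact hI _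
  have hae : ∫ t in brillouinZone, discLap (fun k => latticeKernel k t) m =
      ∫ t in brillouinZone, Real.cos (t.1 * m.1 + t.2 * m.2) := by
    refine setIntegral_congr_ae isCompact_brillouinZone.measurableSet ?_
    have h0 : ∀ᵐ t : ℝ × ℝ, t ≠ 0 := by
      rw [Measure.volume_eq_prod]; exact Measure.ae_ne _ 0
    filter_upwards [h0] with t ht htB
    exact discLap_latticeKernel m (latticeSymbol_pos htB ht).ne'
  rw [hlin, hae, setIntegral_brillouinZone_cos]
  split_ifs
  · exact one_div_mul_cancel (by positivity)
  · exact mul_zero _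

/-- For finitely supported `f`, the convolution `u = φ * f` solves `Au = f`. -/
theorem discLap_latConv (f : ℤ × ℤ → ℝ) (hf : (Function.support f).Finite)
    (m : ℤ × ℤ) : discLap (latConv f) m = f m := by
  have hsum (k : ℤ × ℤ) : latConv f k = ∑ n ∈ hf.toFinset, phi (k - n) * f n := by
    refine finsum_eq_sum_of_support_subset _ fun n hn => ?_
    simpa using right_ne_zero_of_mul hn
  have hlap : discLap (latConv f) m = ∑ n ∈ hf.toFinset, discLap phi (m - n) * f n := by
    simp only [discLap, hsum, Finset.mul_sum, ← Finset.sum_sub_distrib]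
    refine Finset.sum_congr rfl fun n _ => ?_
    rw [add_sub_right_comm m (1, 0), sub_right_comm m (1, 0), add_sub_right_comm m (0, 1),
      sub_right_comm m (0, 1)]
    ring
  simp only [hlap, discLap_phi, sub_eq_zero, ite_mul, one_mul, zero_mul]
  rw [Finset.sum_ite_eq]
  by_cases h : f m = 0 <;> simp [h]
end

section
/- There exists a constant C > 0 such that for every m = (m₁, m₂) ∈ ℤ² with m ≠ (0,0), |φ(m) + (1/(2π)) (log|m| + γ + (log 8)/2)| ≤ C / |m|², where |m| = √(m₁² + m₂²) and γ is the Euler–Mascheroni constant. -/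
open Real MeasureTheory Filter

/-- The Fourier coefficients of `1 / (2 cosh s - 2 cos u)`. -/
noncomputable def poissonIntegral (s : ℝ) (n : ℕ) : ℝ :=
    ∫ u in (-π)..π, Real.cos (n * u) / (2 * Real.cosh s - 2 * Real.cos u)

lemma two_mul_cosh_sub_two_mul_cos_pos {s : ℝ} (hs : 0 < s) (u : ℝ) :
    0 < 2 * Real.cosh s - 2 * Real.cos u := by
  have := Real.one_lt_cosh.2 hs.ne'
  have := Real.cos_le_one u
  linarith

lemma intervalIntegrable_div_cosh_sub_cos {s : ℝ} (hs : 0 < s) {f : ℝ → ℝ} (hf : Continuous f) :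
    IntervalIntegrable (fun u => f u / (2 * Real.cosh s - 2 * Real.cos u)) volume (-π) π := by
  apply Continuous.intervalIntegrable
  exact hf.div (by fun_prop) (fun u => (two_mul_cosh_sub_two_mul_cos_pos hs u).ne')

lemma poissonIntegral_one {s : ℝ} (hs : 0 < s) : poissonIntegral s 1 =
    Real.cosh s * poissonIntegral s 0 - π := by
  have h : (fun u => Real.cos ((1:ℕ) * u) / (2 * Real.cosh s - 2 * Real.cos u)) =
     fun u => Real.cosh s * (Real.cos ((0:ℕ) * u) / (2 * Real.cosh s - 2 * Real.cos u)) - 1 / 2 := by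
    ext u
    have : Real.cosh s - Real.cos u ≠ 0 := fun h => by linarith [two_mul_cosh_sub_two_mul_cos_pos hs u]
    push_cast
    rw [one_mul, zero_mul, Real.cos_zero]
    field_simp
    ring
  unfold poissonIntegral
  rw [h, intervalIntegral.integral_sub, intervalIntegral.integral_const_mul]
  · simp; ring
  · exact (intervalIntegrable_div_cosh_sub_cos hs (by fun_prop)).const_mul _
  · simp

lemma poissonIntegral_add_two {s : ℝ} (hs : 0 < s) (n : ℕ) : poissonIntegral s (n + 2) =
    2 * Real.cosh s * poissonIntegral s (n + 1) - poissonIntegral s n := by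
  have h : (fun u => Real.cos ((n + 2 : ℕ) * u) / (2 * Real.cosh s - 2 * Real.cos u)) =
     fun u => 2 * Real.cosh s * (Real.cos ((n + 1 : ℕ) * u) / (2 * Real.cosh s - 2 * Real.cos u))
      - Real.cos (n * u) / (2 * Real.cosh s - 2 * Real.cos u) - Real.cos ((n + 1 : ℕ) * u) := by
    ext u
    have : Real.cosh s - Real.cos u ≠ 0 := fun h => by linarith [two_mul_cosh_sub_two_mul_cos_pos hs u]
    have e1 : Real.cos ((n + 2 : ℕ) * u) =
        2 * Real.cos u * Real.cos ((n + 1 : ℕ) * u) - Real.cos (n * u) := by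
      have e2 : ((n + 2 : ℕ) : ℝ) * u = (n + 1 : ℕ) * u + u := by push_cast; ring
      have e3 : (n : ℝ) * u = (n + 1 : ℕ) * u - u := by push_cast; ring
      rw [e2, e3, Real.cos_add, Real.cos_sub]; ring
    rw [e1]
    field_simp
    ring
  have h0 : ∫ u in (-π)..π, Real.cos ((n + 1 : ℕ) * u) = 0 := by
    rw [intervalIntegral.integral_comp_mul_left _ (by positivity), integral_cos, mul_neg, Real.sin_neg,
      Real.sin_nat_mul_pi]
    simp
  unfold poissonIntegral
  rw [h, intervalIntegral.integral_sub, intervalIntegral.integral_sub,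
      intervalIntegral.integral_const_mul, h0]
  · ring
  · exact (intervalIntegrable_div_cosh_sub_cos hs (by fun_prop)).const_mul _
  · exact intervalIntegrable_div_cosh_sub_cos hs (by fun_prop)
  · exact ((intervalIntegrable_div_cosh_sub_cos hs
        (by fun_prop)).const_mul _).sub (intervalIntegrable_div_cosh_sub_cos hs (by fun_prop))
  · exact Continuous.intervalIntegrable (by fun_prop) _ _

lemma abs_poissonIntegral_le {s : ℝ} (hs : 0 < s) (n : ℕ) : |poissonIntegral s n| ≤
    poissonIntegral s 0 := by
  unfold poissonIntegral
  have := intervalIntegral.norm_integral_le_of_norm_le (a := -π) (b := π) (μ := volume)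
    (f := fun u => Real.cos (n * u) / (2 * Real.cosh s - 2 * Real.cos u))
    (g := fun u => Real.cos ((0 : ℕ) * u) / (2 * Real.cosh s - 2 * Real.cos u))
    (by linarith [pi_pos]) (ae_of_all _ fun u _ => ?_) (intervalIntegrable_div_cosh_sub_cos hs (by fun_prop))
  · simpa using this
  · rw [Real.norm_eq_abs, abs_div, abs_of_pos (two_mul_cosh_sub_two_mul_cos_pos hs u)]
    have := two_mul_cosh_sub_two_mul_cos_pos hs u
    gcongr
    simpa using Real.abs_cos_le_one _

lemma poissonIntegral_succ {s : ℝ} (hs : 0 < s) (n : ℕ) : poissonIntegral s (n + 1) =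
    Real.exp (-s) * poissonIntegral s n := by
  have key : ∀ k, poissonIntegral s (n + k + 1) - Real.exp (-s) * poissonIntegral s (n + k) =
      Real.exp s ^ k * (poissonIntegral s (n + 1) - Real.exp (-s) * poissonIntegral s n) := by
    intro k
    induction k with
    | zero => simp
    | succ k ih =>
      rw [pow_succ', mul_assoc, ← ih]
      have : poissonIntegral s (n + (k + 1) + 1) = _ := poissonIntegral_add_two hs (n + k)
      rw [this, Real.cosh_eq]
      have : Real.exp s * Real.exp (-s) = 1 := by rw [← Real.exp_add]; simp
      rw [← add_assoc]
      linear_combination poissonIntegral s (n + k) * this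
  by_contra hne
  have hpos : 0 < |poissonIntegral s (n + 1) - Real.exp (-s) * poissonIntegral s n| :=
      abs_pos.2 (sub_ne_zero.2 hne)
  have htop := (tendsto_pow_atTop_atTop_of_one_lt (Real.one_lt_exp_iff.2 hs)).atTop_mul_const hpos
  obtain ⟨k, hk⟩ := (htop.eventually_gt_atTop (2 * poissonIntegral s 0)).exists
  have h1 : Real.exp (-s) ≤ 1 := by simp [hs.le]
  have h2 := congrArg abs (key k)
  rw [abs_mul, abs_pow, abs_of_pos (Real.exp_pos s)] at h2
  have h3 := abs_sub (poissonIntegral s (n + k + 1)) (Real.exp (-s) * poissonIntegral s (n + k))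
  rw [abs_mul, abs_of_pos (Real.exp_pos _)] at h3
  have h4 := mul_le_mul h1 (abs_poissonIntegral_le hs (n+k)) (abs_nonneg _) zero_le_one
  have := abs_poissonIntegral_le hs (n+k+1)
  linarith

lemma poissonIntegral_eq {s : ℝ} (hs : 0 < s) (n : ℕ) : poissonIntegral s n =
    π * Real.exp (-(n * s)) / Real.sinh s := by
  have hs' := Real.sinh_pos_iff.2 hs
  induction n with
  | zero =>
    have h := poissonIntegral_succ hs 0
    rw [zero_add, poissonIntegral_one hs] at h
    have : Real.cosh s - Real.exp (-s) = Real.sinh s := by rw [← Real.cosh_sub_sinh]; ring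
    field_simp
    simp
    linear_combination h - poissonIntegral s 0 * this
  | succ n ih =>
    rw [poissonIntegral_succ hs, ih]
    have : Real.exp (-((n + 1 : ℕ) * s)) = Real.exp (-s) * Real.exp (-(n * s)) := by
      rw [← Real.exp_add]; push_cast; congr 1; ring
    rw [this]; ring

lemma integral_cos_sub_one_div_cosh_sub_cos {s : ℝ} (hs : 0 < s) (n : ℤ) (θ : ℝ) :
    ∫ u in (-π)..π, (Real.cos (θ + u * n) - 1) / (2 * Real.cosh s - 2 * Real.cos u) =
      π * ((Real.cos θ * Real.exp (-(|(n:ℝ)| * s)) - 1) / Real.sinh s) := by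
  have hn : |(n:ℝ)| = (n.natAbs : ℝ) := by simp [Nat.cast_natAbs]
  have hc : ∀ u : ℝ, Real.cos (u * n) = Real.cos (n.natAbs * u) := by
    intro u
    rw [← hn, ← Real.cos_abs (u * n), ← Real.cos_abs (|(n:ℝ)| * u), abs_mul, abs_mul, abs_abs, mul_comm]
  have h1 : ∫ u in (-π)..π, Real.sin (u * n) / (2 * Real.cosh s - 2 * Real.cos u) = 0 := by
    have := intervalIntegral.integral_comp_neg (a := -π) (b := π) (fun u =>
        Real.sin (u * n) / (2 * Real.cosh s - 2 * Real.cos u))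
    simp only [neg_mul, Real.sin_neg, Real.cos_neg, neg_neg, neg_div,
        intervalIntegral.integral_neg] at this
    linarith
  have h : (fun u => (Real.cos (θ + u * n) - 1) / (2 * Real.cosh s - 2 * Real.cos u)) =
     fun u => Real.cos θ * (Real.cos (n.natAbs * u) / (2 * Real.cosh s - 2 * Real.cos u))
      - Real.sin θ * (Real.sin (u * n) / (2 * Real.cosh s - 2 * Real.cos u)) -
          Real.cos ((0 : ℕ) * u) / (2 * Real.cosh s - 2 * Real.cos u) := by
    ext u
    rw [← hc, Real.cos_add]; simp; ring
  rw [h, intervalIntegral.integral_sub, intervalIntegral.integral_sub,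
      intervalIntegral.integral_const_mul,
    intervalIntegral.integral_const_mul, h1]
  · change Real.cos θ * poissonIntegral s n.natAbs - _ - poissonIntegral s 0 = _
    rw [poissonIntegral_eq hs, poissonIntegral_eq hs, hn]; simp; ring
  · exact (intervalIntegrable_div_cosh_sub_cos hs (by fun_prop)).const_mul _
  · exact (intervalIntegrable_div_cosh_sub_cos hs (by fun_prop)).const_mul _
  · exact ((intervalIntegrable_div_cosh_sub_cos hs
        (by fun_prop)).const_mul _).sub ((intervalIntegrable_div_cosh_sub_cos hs (by fun_prop)).const_mul _)
  · exact (intervalIntegrable_div_cosh_sub_cos hs (by fun_prop))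

/-- The decay rate `s` of the lattice-harmonic mode with frequency `t`: `cosh s + cos t = 2`. -/
noncomputable def latticeDecay (t : ℝ) : ℝ := 2 * Real.arsinh (Real.sin (t / 2))

lemma cosh_latticeDecay (t : ℝ) : Real.cosh (latticeDecay t) = 1 + 2 * Real.sin (t / 2) ^ 2 := by
  rw [latticeDecay, Real.cosh_two_mul, Real.cosh_sq, Real.sinh_arsinh]; ring

lemma sinh_latticeDecay (t : ℝ) :
    Real.sinh (latticeDecay t) = 2 * Real.sin (t / 2) * √(1 + Real.sin (t / 2) ^ 2) := by
  rw [latticeDecay, Real.sinh_two_mul, Real.cosh_arsinh, Real.sinh_arsinh]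

lemma continuous_latticeDecay : Continuous latticeDecay :=
  (Real.continuous_arsinh.comp (f := fun t : ℝ => Real.sin (t / 2)) (by fun_prop)).const_mul 2

lemma div_pi_le_sin_half {t : ℝ} (h0 : 0 ≤ t) (h1 : t ≤ π) : t / π ≤ Real.sin (t / 2) := by
  have := Real.mul_le_sin (x := t / 2) (by linarith) (by linarith)
  convert this using 1; ring

lemma half_le_arsinh {y : ℝ} (h0 : 0 ≤ y) (h1 : y ≤ 1) : y / 2 ≤ Real.arsinh y := by
  have h2 : 1 ≤ √(1 + y ^ 2) := by rw [Real.one_le_sqrt]; nlinarith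
  have h3 := Real.one_sub_inv_le_log_of_pos (x := 1 + y) (by linarith)
  have h4 : Real.log (1 + y) ≤ Real.arsinh y := by
    unfold Real.arsinh
    apply Real.log_le_log <;> linarith
  have h5 : y / 2 ≤ 1 - (1 + y)⁻¹ := by
    have : 1 - (1 + y)⁻¹ = y / (1 + y) := by field_simp; ring
    rw [this]; gcongr; linarith
  linarith

lemma arsinh_le_self {y : ℝ} (h0 : 0 ≤ y) : Real.arsinh y ≤ y := by
  have := Real.self_le_sinh_iff.2 (Real.arsinh_nonneg_iff.2 h0)
  rwa [Real.sinh_arsinh] at this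

lemma sub_arsinh_le {y : ℝ} (h0 : 0 ≤ y) : y - Real.arsinh y ≤ y ^ 3 := by
  have hw0 := Real.arsinh_nonneg_iff.2 h0
  have hwy := arsinh_le_self h0
  set w := Real.arsinh y with hw
  have hy : Real.sinh w = y := Real.sinh_arsinh y
  have hc : Real.cosh w ≤ 1 + y ^ 2 := by
    rw [Real.cosh_arsinh, Real.sqrt_le_left (by positivity)]
    nlinarith [sq_nonneg y]
  have hs : Real.sinh w ≤ w * Real.cosh w := by
    have hmono : MonotoneOn (fun x => x * Real.cosh x - Real.sinh x) (Set.Ici 0) := by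
      apply monotoneOn_of_deriv_nonneg (convex_Ici 0) (by fun_prop) (by fun_prop)
      intro x hx
      rw [interior_Ici] at hx
      have hd : HasDerivAt (fun x => x * Real.cosh x - Real.sinh x) (1 * Real.cosh x + x *
          Real.sinh x - Real.cosh x) x :=
        ((hasDerivAt_id x).mul (Real.hasDerivAt_cosh x)).sub (Real.hasDerivAt_sinh x)
      rw [hd.deriv]
      have := Real.sinh_pos_iff.2 hx
      have hx' : 0 < x := hx
      nlinarith [mul_pos hx' this]
    have := hmono (Set.mem_Ici.2 le_rfl) (Set.mem_Ici.2 hw0) hw0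
    simp at this
    linarith
  have h3 : w * Real.cosh w ≤ w * (1 + y ^ 2) := by gcongr
  have h4 : w * y ^ 2 ≤ y * y ^ 2 := by gcongr
  nlinarith

lemma div_pi_le_latticeDecay {t : ℝ} (h0 : 0 ≤ t) (h1 : t ≤ π) : t / π ≤ latticeDecay t := by
  have h2 := div_pi_le_sin_half h0 h1
  have h3 : 0 ≤ t / π := by positivity
  have := half_le_arsinh (h3.trans h2) (Real.sin_le_one _)
  unfold latticeDecay; linarith

lemma latticeDecay_le {t : ℝ} (h0 : 0 ≤ t) (h1 : t ≤ π) : latticeDecay t ≤ t := by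
  have h2 := div_pi_le_sin_half h0 h1
  have h3 : 0 ≤ t / π := by positivity
  have h4 := Real.sin_le (x := t / 2) (by linarith)
  have := arsinh_le_self (h3.trans h2)
  unfold latticeDecay; linarith

lemma sub_latticeDecay_le {t : ℝ} (h0 : 0 ≤ t) (h1 : t ≤ π) : t - latticeDecay t ≤ t ^ 3 / 2 := by
  have h2 := div_pi_le_sin_half h0 h1
  have h3 : 0 ≤ t / π := by positivity
  have h4 := Real.sin_le (x := t / 2) (by linarith)
  have h5 := Real.sin_ge_sub_cube (x := t / 2) (by linarith)
  have h6 := sub_arsinh_le (h3.trans h2)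
  have h7 : Real.sin (t / 2) ^ 3 ≤ (t / 2) ^ 3 := by
    gcongr
    exact h3.trans h2
  have : 0 ≤ t ^ 3 := by positivity
  unfold latticeDecay; linarith

lemma sinh_latticeDecay_ge {t : ℝ} (h0 : 0 ≤ t) (h1 : t ≤ π) :
    2 * t / π ≤ Real.sinh (latticeDecay t) := by
  have h2 := div_pi_le_sin_half h0 h1
  have h3 : 0 ≤ t / π := by positivity
  have h4 : 1 ≤ √(1 + Real.sin (t / 2) ^ 2) := by rw [Real.one_le_sqrt]; nlinarith
  rw [sinh_latticeDecay, mul_div_assoc]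
  nlinarith

lemma abs_sinh_latticeDecay_sub_le {t : ℝ} (h0 : 0 ≤ t) (h1 : t ≤ π) :
    |Real.sinh (latticeDecay t) - t| ≤ t ^ 3 / 4 := by
  have h2 := div_pi_le_sin_half h0 h1
  have h3 : 0 ≤ t / π := by positivity
  have h4 : 1 ≤ √(1 + Real.sin (t / 2) ^ 2) := by rw [Real.one_le_sqrt]; nlinarith
  have h5 : √(1 + Real.sin (t / 2) ^ 2) ≤ 1 + Real.sin (t / 2) ^ 2 / 2 := by
    rw [Real.sqrt_le_left (by positivity)]; nlinarith [sq_nonneg (Real.sin (t / 2) ^ 2)]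
  have h6 := Real.sin_le (x := t / 2) (by linarith)
  have h7 := Real.sin_ge_sub_cube (x := t / 2) (by linarith)
  have h9 := h3.trans h2
  have h8 : Real.sin (t / 2) ^ 3 ≤ (t / 2) ^ 3 := by gcongr
  have : 0 ≤ t ^ 3 := by positivity
  rw [sinh_latticeDecay]
  set y := Real.sin (t / 2)
  rw [abs_le]
  constructor
  · have := mul_le_mul_of_nonneg_left h4 h9
    linarith
  · have := mul_le_mul_of_nonneg_left h5 h9
    nlinarith

lemma abs_inv_sinh_sub_inv_le {t : ℝ} (h0 : 0 < t) (h1 : t ≤ π) :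
    |1 / Real.sinh (latticeDecay t) - 1 / t| ≤ π / 8 * t := by
  have h2 := sinh_latticeDecay_ge h0.le h1
  have h3 := abs_sinh_latticeDecay_sub_le h0.le h1
  have h4 : 0 < 2 * t / π := by positivity
  have hS := h4.trans_le h2
  set S := Real.sinh (latticeDecay t)
  rw [div_sub_div _ _ hS.ne' h0.ne', abs_div, abs_of_pos (mul_pos hS h0), one_mul, mul_one, abs_sub_comm,
    div_le_iff₀ (mul_pos hS h0)]
  calc |S - t| ≤ t ^ 3 / 4 := h3
    _ = π / 8 * t * (2 * t / π * t) := by field_simp; ring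
    _ ≤ _ := by gcongr

lemma abs_exp_div_sub_exp_div_le {t x : ℝ} (h0 : 0 < t) (h1 : t ≤ π) (hx : 0 ≤ x) :
    |Real.exp (-(x * latticeDecay t)) / Real.sinh (latticeDecay t) - Real.exp (-(x * t)) / t| ≤
      (π / 8 * t + x / 2 * t ^ 2) * Real.exp (-(x / π * t)) := by
  have a1 := abs_inv_sinh_sub_inv_le h0 h1
  have a2 := sub_latticeDecay_le h0.le h1
  have a3 := latticeDecay_le h0.le h1
  have a4 := div_pi_le_latticeDecay h0.le h1
  set s := latticeDecay t
  have e1 : Real.exp (-(x * s)) ≤ Real.exp (-(x / π * t)) := by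
    apply Real.exp_le_exp.2
    rw [div_mul_eq_mul_div, mul_div_assoc]
    gcongr
  have e2 : |Real.exp (-(x * s)) - Real.exp (-(x * t))| ≤ Real.exp (-(x * s)) * (x * (t ^ 3 / 2)) := by
    have : Real.exp (-(x * t)) = Real.exp (-(x * s)) * Real.exp (-(x * (t - s))) := by
      rw [← Real.exp_add]; congr 1; ring
    have b1 := Real.add_one_le_exp (-(x * (t - s)))
    have b2 : Real.exp (-(x * (t - s))) ≤ 1 := by
      rw [Real.exp_le_one_iff]; nlinarith
    have b3 : x * (t - s) ≤ x * (t ^ 3 / 2) := by gcongr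
    rw [this, ← mul_one_sub, abs_mul, abs_of_pos (Real.exp_pos _), abs_of_nonneg (by linarith)]
    gcongr
    linarith
  have : Real.exp (-(x * s)) / Real.sinh s - Real.exp (-(x * t)) / t =
     Real.exp (-(x * s)) * (1 / Real.sinh s - 1 / t) +
         (Real.exp (-(x * s)) - Real.exp (-(x * t))) / t := by ring
  rw [this]
  calc _ ≤ _ := abs_add_le _ _
    _ ≤ Real.exp (-(x * s)) * (π / 8 * t) + Real.exp (-(x * s)) * (x * (t ^ 3 / 2)) / t := by
      rw [abs_mul, abs_div, abs_of_pos (Real.exp_pos _), abs_of_pos h0]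
      gcongr
    _ = (π / 8 * t + x / 2 * t ^ 2) * Real.exp (-(x * s)) := by field_simp
    _ ≤ _ := by gcongr

lemma latticeDecay_pos {t : ℝ} (h0 : 0 < t) (h1 : t ≤ π) : 0 < latticeDecay t :=
  lt_of_lt_of_le (by positivity) (div_pi_le_latticeDecay h0.le h1)

lemma intervalIntegrable_inv_sinh_sub :
    IntervalIntegrable (fun t => 1 / Real.sinh (latticeDecay t) - 1 / t) volume 0 π := by
  rw [intervalIntegrable_iff_integrableOn_Ioc_of_le pi_pos.le]
  apply IntegrableOn.of_bound (by simp) _ (π / 8 * π)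
  · refine (ae_restrict_iff' measurableSet_Ioc).2 (ae_of_all _ fun t ht => ?_)
    refine (abs_inv_sinh_sub_inv_le ht.1 ht.2).trans ?_
    have := ht.2
    gcongr
  · apply Measurable.aestronglyMeasurable
    have := continuous_latticeDecay.measurable
    fun_prop

lemma integral_inv_sinh_sub :
    ∫ t in 0..π, (1 / Real.sinh (latticeDecay t) - 1 / t) = Real.log 8 / 2 - Real.log π := by
  let H : ℝ → ℝ := fun t => Real.log (Real.sin (t / 2) / t) -
      Real.log (√(1 + Real.sin (t / 2) ^ 2) + Real.cos (t / 2))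
  have hlim0 : Tendsto H (nhdsWithin 0 (Set.Ioi 0)) (nhds (Real.log (1 / 2) - Real.log (1 + 1))) := by
    apply Tendsto.sub
    · apply Tendsto.log _ (by norm_num)
      have : HasDerivAt (fun t : ℝ => Real.sin (t / 2)) (1 / 2) 0 := by
        have := ((hasDerivAt_id (0:ℝ)).div_const 2).sin
        simpa using this
      have := this.tendsto_slope_zero_right
      simpa [div_eq_inv_mul] using this
    · apply Tendsto.log _ (by norm_num)
      apply Tendsto.mono_left _ nhdsWithin_le_nhds
      have : ContinuousAt (fun t : ℝ => √(1 + Real.sin (t / 2) ^ 2) + Real.cos (t / 2)) 0 := by fun_prop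
      simpa [ContinuousAt] using this
  have hlimπ : Tendsto H (nhdsWithin π (Set.Iio π)) (nhds (Real.log (1 / π) - Real.log (√2))) := by
    apply Tendsto.mono_left _ nhdsWithin_le_nhds
    have : ContinuousAt H π := by
      have h1 : √(1 + Real.sin (π / 2) ^ 2) + Real.cos (π / 2) ≠ 0 := by simp
      have h2 : Real.sin (π / 2) / π ≠ 0 := by simp [pi_ne_zero]
      have := pi_ne_zero
      unfold H
      fun_prop (disch := assumption)
    have h := this.tendsto
    have e : H π = Real.log (1 / π) - Real.log (√2) := by
      simp [H]; norm_num
    rwa [e] at h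
  rw [intervalIntegral.integral_eq_sub_of_hasDerivAt_of_tendsto pi_pos _
      intervalIntegrable_inv_sinh_sub hlim0 hlimπ]
  · have : (8 : ℝ) = 2 ^ 3 := by norm_num
    rw [this, Real.log_pow, Real.log_sqrt (by norm_num)]
    simp
    norm_num
    ring
  · intro t ht
    have hy : 0 < Real.sin (t / 2) := Real.sin_pos_of_pos_of_lt_pi
        (by linarith [ht.1]) (by linarith [ht.1, ht.2])
    have hc : 0 < Real.cos (t / 2) := Real.cos_pos_of_mem_Ioo ⟨by
        linarith [ht.1, pi_pos], by linarith [ht.2]⟩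
    have hr : 0 < √(1 + Real.sin (t / 2) ^ 2) := by positivity
    have hsq : √(1 + Real.sin (t / 2) ^ 2) ^ 2 = 1 + Real.sin (t / 2) ^ 2 := Real.sq_sqrt (by positivity)
    have ht0 : 0 < t := ht.1
    have d1 : HasDerivAt (fun t : ℝ => Real.sin (t / 2)) (Real.cos (t / 2) * (1 / 2)) t :=
      ((hasDerivAt_id t).div_const 2).sin
    have d2 : HasDerivAt (fun t : ℝ => Real.cos (t / 2)) (-Real.sin (t / 2) * (1 / 2)) t :=
      ((hasDerivAt_id t).div_const 2).cos
    have d3 : HasDerivAt (fun t : ℝ => √(1 + Real.sin (t / 2) ^ 2))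
        (2 * Real.sin (t / 2) * (Real.cos (t / 2) * (1 / 2)) / (2 * √(1 + Real.sin (t / 2) ^ 2))) t := by
      simpa using ((d1.pow 2).const_add 1).sqrt (by simp only [Pi.pow_apply]; positivity)
    have d4 : HasDerivAt (fun t : ℝ => Real.sin (t / 2) / t)
        ((Real.cos (t / 2) * (1 / 2) * t - Real.sin (t / 2) * 1) / t ^ 2) t :=
      d1.div (hasDerivAt_id t) ht0.ne'
    have d5 : HasDerivAt
        (fun t : ℝ => √(1 + Real.sin (t / 2) ^ 2) + Real.cos (t / 2)) _ t := d3.add d2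
    refine ((d4.log (by positivity)).sub (d5.log (by positivity))).congr_deriv ?_
    rw [sinh_latticeDecay]
    have hcs := Real.sin_sq_add_cos_sq (t / 2)
    set y := Real.sin (t / 2)
    set c := Real.cos (t / 2)
    set r := √(1 + y ^ 2)
    have hrc : r + c ≠ 0 := by positivity
    have e1 : (c * (1 / 2) * t - y * 1) / t ^ 2 / (y / t) = c / (2 * y) - 1 / t := by field_simp
    have e2 : 1 / (2 * y * r) = c / (2 * y) - (2 * y * (c * (1 / 2)) / (2 * r) + -y * (1 / 2)) /
        (r + c) := by
      field_simp
      linear_combination -r * hcs - c * hsq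
    rw [e1, e2]
    ring

lemma integral_log_mul_exp_neg :
    ∫ t in Set.Ioi (0:ℝ), Real.log t * Real.exp (-t) = -Real.eulerMascheroniConstant := by
  have h1 := Complex.hasDerivAt_GammaIntegral (s := 1) (by simp)
  have h2 : Complex.Gamma =ᶠ[nhds 1] Complex.GammaIntegral := by
    have : {s : ℂ | 0 < s.re} ∈ nhds (1:ℂ) :=
      (isOpen_lt continuous_const Complex.continuous_re).mem_nhds (by simp)
    filter_upwards [this] with s hs using Complex.Gamma_eq_integral hs
  have h3 := (h1.congr_of_eventuallyEq h2).unique Complex.hasDerivAt_Gamma_one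
  have : ∫ t in Set.Ioi (0:ℝ), (t:ℂ) ^ ((1:ℂ) - 1) * ((Real.log t : ℂ) * (Real.exp (-t) : ℂ)) =
      ((∫ t in Set.Ioi (0:ℝ), Real.log t * Real.exp (-t) : ℝ) : ℂ) := by
    rw [← integral_complex_ofReal]
    simp
  rw [this] at h3
  exact_mod_cast h3

lemma integrableOn_log_mul_exp_neg :
    IntegrableOn (fun t => Real.log t * Real.exp (-t)) (Set.Ioi 0) := by
  by_contra h
  have h1 := integral_undef h
  rw [integral_log_mul_exp_neg] at h1
  linarith [Real.one_half_lt_eulerMascheroniConstant]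

/-- The entire exponential integral `Ein`. -/
noncomputable def ein (x : ℝ) : ℝ := ∫ t in 0..x, (1 - Real.exp (-t)) / t

lemma abs_one_sub_exp_neg_div_le {t : ℝ} (ht : 0 < t) : |(1 - Real.exp (-t)) / t| ≤ 1 := by
  have h1 := Real.add_one_le_exp (-t)
  have h2 : Real.exp (-t) ≤ 1 := by simp [ht.le]
  rw [abs_of_nonneg (div_nonneg (by linarith) ht.le), div_le_one ht]
  linarith

lemma intervalIntegrable_ein {x : ℝ} (hx : 0 ≤ x) :
    IntervalIntegrable (fun t => (1 - Real.exp (-t)) / t) volume 0 x := by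
  rw [intervalIntegrable_iff_integrableOn_Ioc_of_le hx]
  apply IntegrableOn.of_bound (by simp) _ 1
  · refine (ae_restrict_iff' measurableSet_Ioc).2 (ae_of_all _ fun t ht => ?_)
    exact abs_one_sub_exp_neg_div_le ht.1
  · apply Measurable.aestronglyMeasurable
    fun_prop

lemma ein_eq {x : ℝ} (hx : 0 < x) :
    ein x = (1 - Real.exp (-x)) * Real.log x - ∫ t in 0..x, Real.log t * Real.exp (-t) := by
  have hI : IntervalIntegrable (fun t => Real.log t * Real.exp (-t)) volume 0 x := by
    rw [intervalIntegrable_iff_integrableOn_Ioc_of_le hx.le]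
    exact integrableOn_log_mul_exp_neg.mono_set Set.Ioc_subset_Ioi_self
  have key := intervalIntegral.integral_eq_sub_of_hasDerivAt_of_tendsto (f := fun t =>
      (1 - Real.exp (-t)) * Real.log t)
    (f' := fun t => Real.log t * Real.exp (-t) + (1 - Real.exp (-t)) / t) (fa := 0)
        (fb := (1 - Real.exp (-x)) * Real.log x) hx
    ?_ (hI.add (intervalIntegrable_ein hx.le)) ?_ ?_
  · rw [intervalIntegral.integral_add hI (intervalIntegrable_ein hx.le)] at key
    unfold ein; linarith
  · intro t ht
    have := (((hasDerivAt_neg t).exp).const_sub 1).mul (Real.hasDerivAt_log ht.1.ne')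
    refine this.congr_deriv ?_
    ring
  · have h1 : Tendsto (fun t => Real.log t * t) (nhdsWithin 0 (Set.Ioi 0)) (nhds 0) := by
      have := (Real.continuous_mul_log.tendsto 0).mono_left
        (nhdsWithin_le_nhds (s := Set.Ioi (0:ℝ)))
      simpa [mul_comm] using this
    have h2 : ∀ t ∈ Set.Ioi (0:ℝ), ‖(1 - Real.exp (-t)) * Real.log t‖ ≤ |Real.log t * t| := by
      intro t ht
      have ht : 0 < t := ht
      have := abs_one_sub_exp_neg_div_le ht
      rw [abs_div, abs_of_pos ht, div_le_one ht] at this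
      rw [Real.norm_eq_abs, abs_mul, abs_mul, abs_of_pos ht, mul_comm]
      gcongr
    refine squeeze_zero_norm' (eventually_nhdsWithin_of_forall h2) ?_
    simpa using h1.abs
  · apply Tendsto.mono_left _ nhdsWithin_le_nhds
    have : ContinuousAt (fun t => (1 - Real.exp (-t)) * Real.log t) x := by
      have := hx.ne'
      fun_prop (disch := assumption)
    exact this

lemma tendsto_log_sub_ein : Tendsto (fun x => Real.log x - ein x) atTop
    (nhds (-Real.eulerMascheroniConstant)) := by
  have h1 := intervalIntegral_tendsto_integral_Ioi 0 integrableOn_log_mul_exp_neg tendsto_id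
  rw [integral_log_mul_exp_neg] at h1
  have h2 : Tendsto (fun x => Real.exp (-x) * Real.log x) atTop (nhds 0) := by
    have h := (Real.tendsto_pow_mul_exp_neg_atTop_nhds_zero 1)
    refine squeeze_zero_norm' ?_ h
    filter_upwards [eventually_ge_atTop 1] with x hx
    rw [norm_mul, Real.norm_eq_abs, abs_of_pos (Real.exp_pos _), Real.norm_eq_abs,
        abs_of_nonneg (Real.log_nonneg hx), pow_one, mul_comm]
    gcongr
    exact (Real.log_le_sub_one_of_pos (by linarith)).trans (by linarith)
  have := h1.add h2
  rw [add_zero] at this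
  refine this.congr' ?_
  filter_upwards [eventually_gt_atTop 0] with x hx
  rw [ein_eq hx]
  simp only [id]
  ring

lemma abs_ein_sub_le {x : ℝ} (hx : 1 ≤ x) :
    |ein x - (Real.log x + Real.eulerMascheroniConstant)| ≤ Real.exp (-x) := by
  have h0 : 0 < x := by linarith
  have key : ∀ y ≥ x, |(Real.log y - ein y) - (Real.log x - ein x)| ≤ Real.exp (-x) := by
    intro y hy
    have e1 : ein y - ein x = ∫ t in x..y, (1 - Real.exp (-t)) / t :=
      intervalIntegral.integral_interval_sub_left
          (intervalIntegrable_ein (by linarith)) (intervalIntegrable_ein (by linarith))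
    have hpos : ∀ t ∈ Set.uIcc x y, t ≠ 0 := by
      intro t ht
      rw [Set.uIcc_of_le hy] at ht
      linarith [ht.1]
    have e2 : Real.log y - Real.log x = ∫ t in x..y, 1 / t := by
      rw [integral_one_div_of_pos h0 (by linarith), Real.log_div (by linarith) (by linarith)]
    have e3 : (Real.log y - ein y) - (Real.log x - ein x) = ∫ t in x..y, Real.exp (-t) / t := by
      have : (Real.log y - ein y) - (Real.log x - ein x) =
          (Real.log y - Real.log x) - (ein y - ein x) := by ring
      rw [this, e1, e2, ← intervalIntegral.integral_sub]
      · congr 1; ext t; ring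
      · apply ContinuousOn.intervalIntegrable
        fun_prop (disch := assumption)
      · apply ContinuousOn.intervalIntegrable
        fun_prop (disch := assumption)
    rw [e3]
    have hb := intervalIntegral.norm_integral_le_of_norm_le (μ := volume) hy (f := fun t =>
        Real.exp (-t) / t) (g := fun t => Real.exp (-t))
      (ae_of_all _ fun t ht => ?_) (Continuous.intervalIntegrable (by fun_prop) _ _)
    · refine hb.trans ?_
      rw [intervalIntegral.integral_comp_neg, integral_exp]
      linarith [Real.exp_pos (-y)]
    · rw [norm_div, Real.norm_eq_abs, Real.norm_eq_abs, abs_of_pos (Real.exp_pos _),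
          abs_of_pos (by linarith [ht.1])]
      exact div_le_self (Real.exp_pos _).le (by linarith [ht.1])
  have lim := (tendsto_log_sub_ein.sub_const (Real.log x - ein x)).abs
  have := le_of_tendsto lim (eventually_atTop.2 ⟨x, key⟩)
  convert this using 1
  congr 1; ring_nf

lemma integral_exp_neg_mul_sin (n κ b : ℝ) (hn : 0 < n) :
    ∫ t in 0..b, Real.exp (-(n * t)) * Real.sin (κ * t) =
      (κ - Real.exp (-(n * b)) * (κ * Real.cos (κ * b) + n * Real.sin (κ * b))) / (n ^ 2 + κ ^ 2) := by
  have hD : n ^ 2 + κ ^ 2 ≠ 0 := by positivity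
  rw [intervalIntegral.integral_eq_sub_of_hasDerivAt (f := fun t =>
      -(Real.exp (-(n * t)) * (κ * Real.cos (κ * t) + n * Real.sin (κ * t))) / (n ^ 2 + κ ^ 2))]
  · simp; ring
  · intro t _
    have d0 : HasDerivAt (fun t => n * t) (n * 1) t := (hasDerivAt_id t).const_mul n
    have d1 : HasDerivAt (fun t => κ * t) (κ * 1) t := (hasDerivAt_id t).const_mul κ
    have := (((d0.neg.exp).mul (((d1.cos).const_mul κ).add ((d1.sin).const_mul n))).neg).div_const
        (n ^ 2 + κ ^ 2)
    refine this.congr_deriv ?_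
    simp only [Pi.add_apply, Pi.neg_apply]
    field_simp
    ring
  · exact Continuous.intervalIntegrable (by fun_prop) _ _

/-- The integral of `(1 - e^{-nt} cos (kt)) / t` over `[0, π]`. -/
noncomputable def einCos (n k : ℝ) : ℝ := ∫ t in 0..π, (1 - Real.exp (-(n * t)) * Real.cos (k * t)) / t

lemma einCos_zero {n : ℝ} (hn : 0 < n) : einCos n 0 = ein (n * π) := by
  unfold einCos ein
  have := intervalIntegral.integral_comp_mul_left (a := 0) (b := π) (fun t =>
      (1 - Real.exp (-t)) / t) hn.ne'
  rw [mul_zero, eq_inv_smul_iff₀ hn.ne', smul_eq_mul, ← intervalIntegral.integral_const_mul] at this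
  rw [← this]
  congr 1; ext t
  rw [← mul_div_mul_left _ t hn.ne']
  simp
  ring_nf

lemma abs_one_sub_exp_mul_cos_div_le {n k t : ℝ} (hn : 0 ≤ n) (ht : 0 < t) :
    |(1 - Real.exp (-(n * t)) * Real.cos (k * t)) / t| ≤ n + |k| := by
  have h1 := Real.add_one_le_exp (-(n * t))
  have h2 : Real.exp (-(n * t)) ≤ 1 := by simp; positivity
  have h3 : |1 - Real.cos (k * t)| ≤ |k| * t := by
    have := Real.abs_cos_sub_cos_le 0 (k * t)
    rwa [Real.cos_zero, zero_sub, abs_neg, abs_mul, abs_of_pos ht] at this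
  rw [abs_div, abs_of_pos ht, div_le_iff₀ ht]
  have : 1 - Real.exp (-(n * t)) * Real.cos (k * t) =
      (1 - Real.exp (-(n * t))) + Real.exp (-(n * t)) * (1 - Real.cos (k * t)) := by ring
  rw [this]
  refine (abs_add_le _ _).trans ?_
  rw [abs_of_nonneg (by linarith), abs_mul, abs_of_pos (Real.exp_pos _)]
  have := mul_le_mul h2 h3 (abs_nonneg _) zero_le_one
  linarith

lemma intervalIntegrable_einCos {n : ℝ} (hn : 0 ≤ n) (k : ℝ) :
    IntervalIntegrable (fun t => (1 - Real.exp (-(n * t)) * Real.cos (k * t)) / t) volume 0 π := by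
  rw [intervalIntegrable_iff_integrableOn_Ioc_of_le pi_pos.le]
  apply IntegrableOn.of_bound (by simp) _ (n + |k|)
  · refine (ae_restrict_iff' measurableSet_Ioc).2 (ae_of_all _ fun t ht => ?_)
    exact abs_one_sub_exp_mul_cos_div_le hn ht.1
  · apply Measurable.aestronglyMeasurable
    fun_prop

lemma einCos_sub {n : ℝ} (hn : 0 < n) (k : ℝ) :
    einCos n k - einCos n 0 = ∫ κ in 0..k, ∫ t in 0..π, Real.exp (-(n * t)) * Real.sin (κ * t) := by
  have hswap : ∫ κ in 0..k, ∫ t in 0..π, Real.exp (-(n * t)) * Real.sin (κ * t) =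
      ∫ t in 0..π, ∫ κ in 0..k, Real.exp (-(n * t)) * Real.sin (κ * t) := by
    refine intervalIntegral_intervalIntegral_swap ?_
    have hcont : Continuous (fun p : ℝ × ℝ => Real.exp (-(n * p.2)) * Real.sin (p.1 * p.2)) := by
      fun_prop
    exact (hcont.continuousOn.integrableOn_compact (isCompact_uIcc.prod isCompact_uIcc)).mono_set
      (Set.prod_mono Set.uIoc_subset_uIcc Set.uIoc_subset_uIcc)
  rw [hswap]
  unfold einCos
  rw [← intervalIntegral.integral_sub (intervalIntegrable_einCos hn.le k)
      (intervalIntegrable_einCos hn.le 0)]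
  apply intervalIntegral.integral_congr_ae
  refine ae_of_all _ fun t ht => ?_
  rw [Set.uIoc_of_le pi_pos.le] at ht
  have := ht.1.ne'
  rw [intervalIntegral.integral_const_mul, intervalIntegral.integral_comp_mul_right _ this, integral_sin]
  simp
  field_simp
  ring

lemma abs_einCos_sub_le {n k : ℝ} (hn : 1 ≤ n) (hk : |k| ≤ n) :
    |einCos n k - (Real.log (√(k ^ 2 + n ^ 2)) + Real.log π + Real.eulerMascheroniConstant)| ≤
        3 * Real.exp (-(n * π)) := by
  have hn0 : 0 < n := by linarith
  have hn' : 1 ≤ n * π := by nlinarith [Real.pi_gt_three]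
  have h1 := abs_ein_sub_le hn'
  rw [← einCos_zero hn0] at h1
  have h2 := einCos_sub hn0 k
  simp_rw [integral_exp_neg_mul_sin _ _ _ hn0] at h2
  have hD : ∀ κ : ℝ, n ^ 2 + κ ^ 2 ≠ 0 := fun κ => by positivity
  have e1 : ∫ κ in 0..k, κ / (n ^ 2 + κ ^ 2) = Real.log (√(k ^ 2 + n ^ 2)) - Real.log n := by
    rw [intervalIntegral.integral_eq_sub_of_hasDerivAt (f := fun κ => Real.log (n ^ 2 + κ ^ 2) / 2)]
    · rw [Real.log_sqrt (by positivity), add_comm (k ^ 2)]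
      simp
    · intro κ _
      have := ((((hasDerivAt_id κ).pow 2).const_add (n ^ 2)).log (hD κ)).div_const 2
      refine this.congr_deriv ?_
      simp
      field_simp
    · apply Continuous.intervalIntegrable
      fun_prop (disch := assumption)
  have e2 : |∫ κ in 0..k, Real.exp (-(n * π)) * (κ * Real.cos (κ * π) + n * Real.sin (κ * π)) /
      (n ^ 2 + κ ^ 2)| ≤
      2 * Real.exp (-(n * π)) := by
    have := intervalIntegral.norm_integral_le_of_norm_le_const (a := 0) (b := k)
        (C := Real.exp (-(n * π)) * (2 / n))
      (f := fun κ => Real.exp (-(n * π)) * (κ * Real.cos (κ * π) + n * Real.sin (κ * π)) /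
          (n ^ 2 + κ ^ 2)) ?_
    · refine this.trans ?_
      rw [sub_zero]
      calc _ ≤ Real.exp (-(n * π)) * (2 / n) * n := by gcongr
        _ = _ := by field_simp
    · intro κ hκ
      have hκ' : |κ| ≤ n := by
        rcases Set.mem_uIoc.1 hκ with h | h
        · rw [abs_of_pos h.1]; exact h.2.trans ((le_abs_self _).trans hk)
        · rw [abs_of_nonpos h.2]; have := neg_abs_le k; linarith
      rw [mul_div_assoc, norm_mul, Real.norm_eq_abs, Real.norm_eq_abs, abs_of_pos (Real.exp_pos _),
          abs_div, abs_of_pos (by positivity : 0 < n ^ 2 + κ ^ 2)]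
      refine mul_le_mul_of_nonneg_left ?_ (Real.exp_pos _).le
      rw [div_le_div_iff₀ (by positivity) hn0]
      have b1 : |κ * Real.cos (κ * π) + n * Real.sin (κ * π)| ≤ n * 1 + n * 1 := by
        refine (abs_add_le _ _).trans ?_
        rw [abs_mul, abs_mul, abs_of_pos hn0]
        gcongr
        · exact Real.abs_cos_le_one _
        · exact Real.abs_sin_le_one _
      nlinarith [sq_nonneg κ]
  simp_rw [sub_div] at h2
  rw [intervalIntegral.integral_sub, e1] at h2
  · rw [Real.log_mul (by positivity) (by positivity)] at h1
    rw [abs_le] at *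
    constructor <;> linarith [h1.1, h1.2, e2.1, e2.2]
  · apply Continuous.intervalIntegrable
    fun_prop (disch := assumption)
  · apply Continuous.intervalIntegrable
    fun_prop (disch := assumption)

lemma four_mul_sin_half_sq_ge {t : ℝ} (ht : t ∈ Set.Icc (-π) π) :
    4 / π ^ 2 * t ^ 2 ≤ 4 * Real.sin (t / 2) ^ 2 := by
  have h := div_pi_le_sin_half (abs_nonneg t) (abs_le.2 ht)
  have h2 : Real.sin (|t| / 2) ^ 2 = Real.sin (t / 2) ^ 2 := by
    rcases abs_choice t with h | h <;> simp [h, neg_div]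
  rw [← h2]
  calc 4 / π ^ 2 * t ^ 2 = 4 * (|t| / π) ^ 2 := by rw [div_pow, sq_abs]; ring
    _ ≤ _ := by gcongr

lemma abs_latticeKernel_le (m : ℤ × ℤ) {t : ℝ × ℝ}
    (ht : t ∈ Set.Icc (-π) π ×ˢ Set.Icc (-π) π) :
    |latticeKernel m t| ≤ ((m.1 : ℝ) ^ 2 + (m.2 : ℝ) ^ 2) * π ^ 2 / 8 := by
  have h1 := four_mul_sin_half_sq_ge ht.1
  have h2 := four_mul_sin_half_sq_ge ht.2
  have h3 := Real.one_sub_sq_div_two_le_cos (x := t.1 * (m.1 : ℝ) + t.2 * (m.2 : ℝ))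
  have h4 := Real.cos_le_one (t.1 * (m.1 : ℝ) + t.2 * (m.2 : ℝ))
  unfold latticeKernel
  rw [abs_div, abs_of_nonneg (a := _ + _) (by positivity), abs_of_nonpos (by linarith)]
  apply div_le_of_le_mul₀ (by positivity) (by positivity)
  calc -(Real.cos (t.1 * (m.1 : ℝ) + t.2 * (m.2 : ℝ)) - 1)
      ≤ ((m.1 : ℝ) ^ 2 + (m.2 : ℝ) ^ 2) * (t.1 ^ 2 + t.2 ^ 2) / 2 := by
        nlinarith [sq_nonneg (t.1 * (m.2 : ℝ) - t.2 * (m.1 : ℝ))]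
    _ = ((m.1 : ℝ) ^ 2 + (m.2 : ℝ) ^ 2) * π ^ 2 / 8 * (4 / π ^ 2 * t.1 ^ 2 + 4 / π ^ 2 * t.2 ^ 2) := by
        field_simp; ring
    _ ≤ _ := by gcongr

lemma integrableOn_latticeKernel_s8 (m : ℤ × ℤ) :
    IntegrableOn (latticeKernel m) (Set.Icc (-π) π ×ˢ Set.Icc (-π) π) := by
  apply IntegrableOn.of_bound _ _ (((m.1 : ℝ) ^ 2 + (m.2 : ℝ) ^ 2) * π ^ 2 / 8)
  · exact (ae_restrict_iff' (measurableSet_Icc.prod measurableSet_Icc)).2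
      (ae_of_all _ fun t ht => abs_latticeKernel_le m ht)
  · exact (isCompact_Icc.prod isCompact_Icc).measure_lt_top
  · apply Measurable.aestronglyMeasurable
    unfold latticeKernel
    fun_prop

lemma phi_swap (m : ℤ × ℤ) : phi m.swap = phi m := by
  unfold phi
  congr 1
  rw [Measure.volume_eq_prod, ← setIntegral_prod_swap]
  congr 1
  ext t
  simp only [latticeKernel, Prod.fst_swap, Prod.snd_swap]
  rw [add_comm, add_comm (4 * _)]

lemma integral_latticeKernel_snd (m : ℤ × ℤ) {t : ℝ} (h0 : 0 < t) (h1 : t ≤ π) :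
    ∫ u in (-π)..π, latticeKernel m (t, u) =
      π * ((Real.cos (m.1 * t) * Real.exp (-(|(m.2 : ℝ)| * latticeDecay t)) - 1) /
        Real.sinh (latticeDecay t)) := by
  rw [mul_comm (m.1 : ℝ) t, ← integral_cos_sub_one_div_cosh_sub_cos (latticeDecay_pos h0 h1)]
  congr 1
  ext u
  have : 4 * Real.sin (u / 2) ^ 2 = 2 - 2 * Real.cos u := by
    rw [Real.sin_sq_eq_half_sub]
    ring_nf
  simp only [latticeKernel, cosh_latticeDecay]
  congr 1
  linear_combination this

lemma phi_eq_intervalIntegral (m : ℤ × ℤ) :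
    phi m = 1 / (2 * π) * ∫ t in 0..π,
      (Real.cos (m.1 * t) * Real.exp (-(|(m.2 : ℝ)| * latticeDecay t)) - 1) /
        Real.sinh (latticeDecay t) := by
  let g : ℝ → ℝ := fun t => ∫ u in (-π)..π, latticeKernel m (t, u)
  have hpi : -π ≤ π := by linarith [pi_pos]
  have hint := integrableOn_latticeKernel_s8 m
  have h1 : ∫ t in Set.Icc (-π) π ×ˢ Set.Icc (-π) π, latticeKernel m t = ∫ t in (-π)..π, g t := by
    rw [Measure.volume_eq_prod, setIntegral_prod _ hint]
    simp only [g, integral_Icc_eq_integral_Ioc, intervalIntegral.integral_of_le hpi]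
  have hg : IntervalIntegrable g volume (-π) π := by
    rw [intervalIntegrable_iff_integrableOn_Icc_of_le hpi]
    rw [IntegrableOn, Measure.volume_eq_prod, ← Measure.prod_restrict] at hint
    simpa only [g, intervalIntegral.integral_of_le hpi, ← integral_Icc_eq_integral_Ioc, IntegrableOn]
      using hint.integral_prod_left
  have heven : ∀ t, g (-t) = g t := by
    intro t
    have := intervalIntegral.integral_comp_neg (a := -π) (b := π) (fun u => latticeKernel m (-t, u))
    rw [neg_neg] at this
    simp only [g]
    rw [← this]
    congr 1
    ext u
    simp only [latticeKernel, neg_mul, neg_div, Real.sin_neg, neg_sq]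
    rw [← neg_add, Real.cos_neg]
  have hzero : (0:ℝ) ∈ Set.uIcc (-π) π := by
    rw [Set.uIcc_of_le hpi]; exact ⟨by linarith [pi_pos], pi_pos.le⟩
  have h2 : ∫ t in (-π)..π, g t = 2 * ∫ t in 0..π, g t := by
    rw [← intervalIntegral.integral_add_adjacent_intervals (b := 0)
      (hg.mono_set (Set.uIcc_subset_uIcc_left hzero))
      (hg.mono_set (Set.uIcc_subset_uIcc_right hzero))]
    have := intervalIntegral.integral_comp_neg (a := 0) (b := π) g
    simp only [heven, neg_zero] at this
    rw [← this]; ring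
  have h3 : ∫ t in 0..π, g t = ∫ t in 0..π, π *
      ((Real.cos (m.1 * t) * Real.exp (-(|(m.2 : ℝ)| * latticeDecay t)) - 1) /
        Real.sinh (latticeDecay t)) := by
    apply intervalIntegral.integral_congr_ae
    refine ae_of_all _ fun t ht => ?_
    rw [Set.uIoc_of_le pi_pos.le] at ht
    exact integral_latticeKernel_snd m ht.1 ht.2
  unfold phi
  rw [h1, h2, h3, intervalIntegral.integral_const_mul]
  field_simp

lemma integrableOn_pow_mul_exp_neg (j : ℕ) {a : ℝ} (ha : 0 < a) :
    IntegrableOn (fun t => t ^ j * Real.exp (-(a * t))) (Set.Ioi 0) := by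
  have := integrableOn_rpow_mul_exp_neg_mul_rpow (s := j) (p := 1) (b := a)
    (by have : (0:ℝ) ≤ j := j.cast_nonneg
        linarith) one_pos ha
  simpa using this

lemma integral_pow_mul_exp_neg (j : ℕ) {a : ℝ} (ha : 0 < a) :
    ∫ t in Set.Ioi (0:ℝ), t ^ j * Real.exp (-(a * t)) = j.factorial / a ^ (j + 1) := by
  have := Real.integral_rpow_mul_exp_neg_mul_Ioi (a := j + 1) (by positivity) ha
  rw [Real.Gamma_nat_eq_factorial] at this
  simp only [add_sub_cancel_right, Real.rpow_natCast] at this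
  rw [this]
  have : (1 / a) ^ ((j : ℝ) + 1) = (1 / a) ^ (j + 1)
      := by exact_mod_cast Real.rpow_natCast (1 / a) (j + 1)
  rw [this, one_div, inv_pow, div_eq_inv_mul]

lemma abs_integral_exp_div_sub_le {n : ℝ} (hn : 0 < n) (k : ℝ) :
    |∫ t in 0..π, Real.cos (k * t) * (Real.exp (-(n * latticeDecay t)) / Real.sinh (latticeDecay t) -
      Real.exp (-(n * t)) / t)| ≤ 9 * π ^ 3 / 8 / n ^ 2 := by
  have ha : 0 < n / π := by positivity
  let g : ℝ → ℝ := fun t => π / 8 * (t ^ 1 * Real.exp (-(n / π * t))) +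
    n / 2 * (t ^ 2 * Real.exp (-(n / π * t)))
  have i1 := (integrableOn_pow_mul_exp_neg 1 ha).const_mul (π / 8)
  have i2 := (integrableOn_pow_mul_exp_neg 2 ha).const_mul (n / 2)
  have hgI : IntegrableOn g (Set.Ioi 0) := i1.add i2
  have hg : ∫ t in Set.Ioi 0, g t = 9 * π ^ 3 / 8 / n ^ 2 := by
    simp only [g]
    rw [integral_add i1 i2, integral_const_mul, integral_const_mul, integral_pow_mul_exp_neg _ ha,
      integral_pow_mul_exp_neg _ ha]
    simp [Nat.factorial]
    field_simp
    norm_num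
  rw [← hg]
  have hb := intervalIntegral.norm_integral_le_of_norm_le (μ := volume) pi_pos.le (g := g)
    (f := fun t => Real.cos (k * t) * (Real.exp (-(n * latticeDecay t)) / Real.sinh (latticeDecay t) -
      Real.exp (-(n * t)) / t)) (ae_of_all _ fun t ht => ?_) ?_
  · refine hb.trans ?_
    rw [intervalIntegral.integral_of_le pi_pos.le]
    refine setIntegral_mono_set hgI ?_ Set.Ioc_subset_Ioi_self.eventuallyLE
    refine (ae_restrict_iff' measurableSet_Ioi).2 (ae_of_all _ fun t ht => ?_)
    have ht : 0 < t := ht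
    simp only [g, Pi.zero_apply]
    positivity
  · have := abs_exp_div_sub_exp_div_le ht.1 ht.2 hn.le
    rw [Real.norm_eq_abs, abs_mul]
    refine (mul_le_of_le_one_left (abs_nonneg _) (Real.abs_cos_le_one _)).trans (this.trans_eq ?_)
    simp only [g]; ring
  · exact (intervalIntegrable_iff_integrableOn_Ioc_of_le pi_pos.le).2
        (hgI.mono_set Set.Ioc_subset_Ioi_self)

lemma intervalIntegrable_exp_div_sub {n : ℝ} (hn : 0 ≤ n) (k : ℝ) :
    IntervalIntegrable (fun t => Real.cos (k * t) *
      (Real.exp (-(n * latticeDecay t)) / Real.sinh (latticeDecay t) - Real.exp (-(n * t)) / t))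
      volume 0 π := by
  rw [intervalIntegrable_iff_integrableOn_Ioc_of_le pi_pos.le]
  apply IntegrableOn.of_bound (by simp) _ (π / 8 * π + n / 2 * π ^ 2)
  · refine (ae_restrict_iff' measurableSet_Ioc).2 (ae_of_all _ fun t ht => ?_)
    have := abs_exp_div_sub_exp_div_le ht.1 ht.2 hn
    rw [Real.norm_eq_abs, abs_mul]
    refine (mul_le_of_le_one_left (abs_nonneg _) (Real.abs_cos_le_one _)).trans (this.trans ?_)
    have h0 := ht.1
    have h1 := ht.2
    refine (mul_le_of_le_one_right (by positivity) ?_).trans ?_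
    · rw [Real.exp_le_one_iff, neg_nonpos]; positivity
    · gcongr
  · apply Measurable.aestronglyMeasurable
    have := continuous_latticeDecay.measurable
    fun_prop

lemma integral_cos_mul_exp_sub_one_div {n : ℝ} (hn : 0 ≤ n) (k : ℝ) :
    ∫ t in 0..π, (Real.cos (k * t) * Real.exp (-(n * latticeDecay t)) - 1) /
        Real.sinh (latticeDecay t) =
      (∫ t in 0..π, Real.cos (k * t) *
        (Real.exp (-(n * latticeDecay t)) / Real.sinh (latticeDecay t) - Real.exp (-(n * t)) / t)) -
      (Real.log 8 / 2 - Real.log π) - einCos n k := by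
  rw [← integral_inv_sinh_sub, einCos,
    ← intervalIntegral.integral_sub (intervalIntegrable_exp_div_sub hn k)
      intervalIntegrable_inv_sinh_sub,
    ← intervalIntegral.integral_sub ((intervalIntegrable_exp_div_sub hn k).sub
      intervalIntegrable_inv_sinh_sub) (intervalIntegrable_einCos hn k)]
  congr 1
  ext t
  ring

lemma exp_neg_mul_pi_le {n : ℝ} (hn : 0 < n) : Real.exp (-(n * π)) ≤ 1 / n ^ 2 := by
  rw [Real.exp_neg, ← one_div]
  have h1 : n ≤ Real.exp n := by linarith [Real.add_one_le_exp n]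
  have : n ^ 2 ≤ Real.exp (n * π) := by
    calc n ^ 2 ≤ Real.exp n ^ 2 := by gcongr
      _ = Real.exp (n * 2) := by rw [← Real.exp_nat_mul]; push_cast; rw [mul_comm]
      _ ≤ _ := by
        apply Real.exp_le_exp.2
        gcongr
        exact Real.two_le_pi
  gcongr

lemma latNorm_sq (m : ℤ × ℤ) : latNorm m ^ 2 = (m.1 : ℝ) ^ 2 + (m.2 : ℝ) ^ 2 :=
  Real.sq_sqrt (by positivity)

lemma latNorm_swap (m : ℤ × ℤ) : latNorm m.swap = latNorm m := by
  simp [latNorm, add_comm]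

lemma abs_phi_add_le_of_abs_le {m : ℤ × ℤ} (hm : m ≠ (0, 0)) (h : |m.1| ≤ |m.2|) :
    |phi m + (1 / (2 * Real.pi)) *
        (Real.log (latNorm m) + Real.eulerMascheroniConstant + Real.log 8 / 2)|
      ≤ (2 * (9 * π ^ 3 / 8 + 3)) / latNorm m ^ 2 := by
  have h2 : m.2 ≠ 0 := by
    intro h0
    rw [h0, abs_zero, abs_nonpos_iff] at h
    exact hm (Prod.ext h h0)
  have hn1 : (1:ℝ) ≤ |(m.2 : ℝ)| := by exact_mod_cast Int.one_le_abs h2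
  have hk : |(m.1 : ℝ)| ≤ |(m.2 : ℝ)| := by exact_mod_cast h
  have hnorm : √((m.1 : ℝ) ^ 2 + |(m.2 : ℝ)| ^ 2) = latNorm m := by rw [sq_abs, latNorm]
  have hsq : latNorm m ^ 2 ≤ 2 * |(m.2 : ℝ)| ^ 2 := by
    have := sq_le_sq.2 hk
    rw [latNorm_sq, sq_abs]
    linarith
  have hpos : 0 < latNorm m ^ 2 := by
    have : (m.2 : ℝ) ≠ 0 := Int.cast_ne_zero.2 h2
    rw [latNorm_sq]; positivity
  have hE := abs_einCos_sub_le hn1 hk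
  rw [phi_eq_intervalIntegral, integral_cos_mul_exp_sub_one_div (abs_nonneg _)]
  rw [hnorm] at hE
  have hR := abs_integral_exp_div_sub_le (by linarith : 0 < |(m.2 : ℝ)|) m.1
  have hX := exp_neg_mul_pi_le (by linarith : 0 < |(m.2 : ℝ)|)
  generalize |(m.2 : ℝ)| = n at *
  set R := ∫ t in 0..π, Real.cos ((m.1 : ℝ) * t) *
        (Real.exp (-(n * latticeDecay t)) / Real.sinh (latticeDecay t) - Real.exp (-(n * t)) / t)
  have hn0 : 0 < n := by linarith
  rw [← mul_add, abs_mul, abs_of_pos (by positivity)]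
  have h3 : 1 / (2 * π) ≤ 1 := by
    rw [div_le_one (by positivity)]; linarith [Real.pi_gt_three]
  refine (mul_le_of_le_one_left (abs_nonneg _) h3).trans ?_
  calc _ = |R - (einCos n m.1 - (Real.log (latNorm m) + Real.log π + Real.eulerMascheroniConstant))| := by
        congr 1; ring
    _ ≤ _ := abs_sub _ _
    _ ≤ 9 * π ^ 3 / 8 / n ^ 2 + 3 * (1 / n ^ 2) := by linarith
    _ = 2 * (9 * π ^ 3 / 8 + 3) / (2 * n ^ 2) := by field_simp
    _ ≤ _ := by gcongr

/-- Leading-order asymptotics of the lattice fundamental solution: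
`φ(m) = −(1/2π)(log|m| + γ + (log 8)/2) + O(1/|m|²)`. -/
theorem phi_asymptotics_leading :
    ∃ C : ℝ, 0 < C ∧ ∀ m : ℤ × ℤ, m ≠ (0, 0) →
      |phi m + (1 / (2 * Real.pi)) *
          (Real.log (latNorm m) + Real.eulerMascheroniConstant + Real.log 8 / 2)|
        ≤ C / latNorm m ^ 2 := by
  refine ⟨2 * (9 * π ^ 3 / 8 + 3), by positivity, fun m hm => ?_⟩
  rcases le_total |m.1| |m.2| with h | h
  · exact abs_phi_add_le_of_abs_le hm h
  · have hm' : m.swap ≠ (0, 0) := fun h0 => hm (Prod.swap_injective h0)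
    have := abs_phi_add_le_of_abs_le hm' h
    rwa [phi_swap, latNorm_swap] at this
end
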